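/- arXiv:2108.08011 — 3 statements merged into one kernel-verified Lean document; each statement's English description precedes it below -/
import Mathlib

section
/- Let n ≥ 1 and m ≥ 1 be integers and let S be an n×n Hermitian positive definite complex matrix. Then every n×n Hermitian positive definite complex matrix R satisfies (det R)^{-m} · exp(−Re tr(R⁻¹ S)) ≤ m^{mn} · e^{−mn} · (det S)^{-m}. (Equivalently, the Gaussian-likelihood profile R ↦ det(R)^{-m} exp(−tr(R⁻¹S)) over positive definite covariance matrices is maximized at R = S/m.) -/
open Matrix
open scoped ComplexOrder

/-- The function `t ↦ t ^ m * exp (-t)` on the nonnegative reals is maximal at `t = m`. -/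
theorem Real.pow_mul_exp_neg_le {m : ℕ} (hm : m ≠ 0) {t : ℝ} (ht : 0 ≤ t) :
    t ^ m * Real.exp (-t) ≤ (m : ℝ) ^ m * Real.exp (-(m : ℝ)) := by
  have hm' : (0 : ℝ) < m := by positivity
  have h : t / m ≤ Real.exp (t / m - 1) := by
    linarith [Real.add_one_le_exp (t / m - 1)]
  have hpow : t ^ m ≤ (m : ℝ) ^ m * Real.exp (t - m) := by
    calc t ^ m = (m : ℝ) ^ m * (t / m) ^ m := by rw [← mul_pow, mul_div_cancel₀ _ hm'.ne']
      _ ≤ (m : ℝ) ^ m * Real.exp (t / m - 1) ^ m := by gcongr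
      _ = (m : ℝ) ^ m * Real.exp (t - m) := by
        rw [← Real.exp_nat_mul, mul_sub, mul_div_cancel₀ _ hm'.ne', mul_one]
  calc t ^ m * Real.exp (-t) ≤ (m : ℝ) ^ m * Real.exp (t - m) * Real.exp (-t) := by gcongr
    _ = (m : ℝ) ^ m * Real.exp (-(m : ℝ)) := by
      rw [mul_assoc, ← Real.exp_add]
      congr 2
      ring

open scoped MatrixOrder in
theorem Matrix.PosDef.exists_isUnit_eq_conjTranspose_mul_self {ι : Type*} [Fintype ι]
    [DecidableEq ι] {A : Matrix ι ι ℂ} (hA : A.PosDef) :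
    ∃ B : Matrix ι ι ℂ, IsUnit B ∧ A = Bᴴ * B := by
  obtain ⟨B, hB⟩ := CStarAlgebra.nonneg_iff_eq_star_mul_self.mp hA.posSemidef.nonneg
  rw [star_eq_conjTranspose] at hB
  exact ⟨B, isUnit_of_mul_isUnit_right (hB ▸ hA.isUnit), hB⟩

theorem Matrix.PosDef.det_pow_mul_exp_neg_trace_le {ι : Type*} [Fintype ι] [DecidableEq ι]
    {T : Matrix ι ι ℂ} (hT : T.PosDef) {m : ℕ} (hm : m ≠ 0) :
    T.det.re ^ m * Real.exp (-T.trace.re) ≤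
      ((m : ℝ) ^ m * Real.exp (-(m : ℝ))) ^ Fintype.card ι := by
  have hdet : T.det.re = ∏ i, hT.isHermitian.eigenvalues i := by
    rw [hT.isHermitian.det_eq_prod_eigenvalues]
    norm_cast
  have htrace : T.trace.re = ∑ i, hT.isHermitian.eigenvalues i := by
    rw [hT.isHermitian.trace_eq_sum_eigenvalues]
    norm_cast
  rw [hdet, htrace, ← Finset.prod_pow, ← Finset.sum_neg_distrib, Real.exp_sum,
    ← Finset.prod_mul_distrib, ← Finset.card_univ,
    ← Finset.prod_const]
  refine Finset.prod_le_prod (fun i _ ↦ ?_) fun i _ ↦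
    Real.pow_mul_exp_neg_le hm (hT.eigenvalues_pos i).le
  have := hT.eigenvalues_pos i
  positivity

/-- For integers `n, m ≥ 1` and an `n×n` Hermitian positive definite complex
matrix `S`, every Hermitian positive definite `R` satisfies
`(det R)^{-m} · exp(−Re tr(R⁻¹ S)) ≤ m^{mn} · e^{−mn} · (det S)^{-m}`. -/
theorem gaussian_profile_bound (n m : ℕ) (hn : 1 ≤ n) (hm : 1 ≤ m)
    (S : Matrix (Fin n) (Fin n) ℂ) (hS : S.PosDef)
    (R : Matrix (Fin n) (Fin n) ℂ) (hR : R.PosDef) :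
    (R.det.re)⁻¹ ^ m * Real.exp (-((R⁻¹ * S).trace.re)) ≤
      (m : ℝ) ^ (m * n) * Real.exp (-((m : ℝ) * n)) * (S.det.re)⁻¹ ^ m := by
  obtain ⟨B, hBunit, hB⟩ := hR.inv.exists_isUnit_eq_conjTranspose_mul_self
  have hT : (B * S * Bᴴ).PosDef := (IsUnit.posDef_star_right_conjugate_iff hBunit).mpr hS
  have htrace : (B * S * Bᴴ).trace = (R⁻¹ * S).trace := by
    rw [hB, trace_mul_comm, Matrix.mul_assoc]
  obtain ⟨hRre, hRim⟩ := Complex.pos_iff.mp hR.det_pos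
  have hSre := (Complex.pos_iff.mp hS.det_pos).1
  have hRdet : R.det = (R.det.re : ℂ) := Complex.ext rfl (by simp [← hRim])
  have hdet : (B * S * Bᴴ).det.re = S.det.re / R.det.re := by
    have h : (B * S * Bᴴ).det = S.det / R.det := by
      have hinv : Bᴴ.det * B.det = R.det⁻¹ := by
        rw [← det_mul, ← hB, det_nonsing_inv, Ring.inverse_eq_inv']
      rw [det_mul, det_mul, div_eq_mul_inv, ← hinv]
      ring
    rw [h, hRdet, Complex.div_ofReal_re, Complex.ofReal_re]
  have key := hT.det_pow_mul_exp_neg_trace_le (Nat.one_le_iff_ne_zero.mp hm)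
  rw [htrace, hdet, Fintype.card_fin, mul_pow, ← pow_mul, ← Real.exp_nat_mul, div_pow] at key
  rw [inv_pow, inv_pow, ← div_eq_mul_inv _ (S.det.re ^ m), le_div_iff₀ (by positivity)]
  calc (R.det.re ^ m)⁻¹ * Real.exp (-(R⁻¹ * S).trace.re) * S.det.re ^ m
      = S.det.re ^ m / R.det.re ^ m * Real.exp (-(R⁻¹ * S).trace.re) := by
        rw [div_eq_mul_inv, mul_comm, mul_assoc]
    _ ≤ (m : ℝ) ^ (m * n) * Real.exp (n * -(m : ℝ)) := key
    _ = (m : ℝ) ^ (m * n) * Real.exp (-((m : ℝ) * n)) := by rw [mul_neg, mul_comm (n : ℝ)]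
end

section
/- Let n ≥ 1 and m ≥ 1 be integers and let S be an n×n Hermitian positive definite complex matrix. For an n×n Hermitian positive definite matrix R, equality (det R)^{-m} · exp(−Re tr(R⁻¹ S)) = m^{mn} · e^{−mn} · (det S)^{-m} holds if and only if R = (1/m)·S; that is, R = (1/m)S is the unique maximizer of R ↦ (det R)^{-m} exp(−Re tr(R⁻¹S)) over Hermitian positive definite matrices. -/
open Matrix
open scoped ComplexOrder

section LogDetTrace

variable {ι : Type*} [Fintype ι] [DecidableEq ι]

/-- Among positive definite matrices, only the identity attains equality in
`log det A ≤ tr A - card ι`. -/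
theorem Matrix.PosDef.log_det_eq_trace_sub_card_iff {A : Matrix ι ι ℂ} (hA : A.PosDef) :
    Real.log A.det.re = A.trace.re - Fintype.card ι ↔ A = 1 := by
  constructor
  · intro h
    have hdet : A.det.re = ∏ i, hA.1.eigenvalues i := by
      rw [hA.1.det_eq_prod_eigenvalues]
      exact_mod_cast rfl
    have htrace : A.trace.re = ∑ i, hA.1.eigenvalues i := by
      rw [hA.1.trace_eq_sum_eigenvalues]
      exact_mod_cast rfl
    rw [hdet, htrace, Real.log_prod fun i _ => (hA.eigenvalues_pos i).ne'] at h
    have hsum : ∑ i, Real.log (hA.1.eigenvalues i) = ∑ i, (hA.1.eigenvalues i - 1) := by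
      simpa [Finset.sum_sub_distrib] using h
    have heq := (Finset.sum_eq_sum_iff_of_le fun i _ =>
      Real.log_le_sub_one_of_pos (hA.eigenvalues_pos i)).1 hsum
    have hone : hA.1.eigenvalues = 1 := by
      funext i
      by_contra hi
      exact (Real.log_lt_sub_one_of_pos (hA.eigenvalues_pos i) hi).ne (heq i (Finset.mem_univ i))
    rw [hA.1.spectral_theorem, hone]
    have hdiag : diagonal ((RCLike.ofReal : ℝ → ℂ) ∘ (1 : ι → ℝ)) = 1 := by
      ext i j
      simp [diagonal_apply, one_apply]
    rw [hdiag, map_one]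
  · rintro rfl
    simp

/-- For positive definite `R` and `S`, equality in `log det S - log det R ≤ tr (R⁻¹ S) - card ι`
forces `R = S`. -/
theorem Matrix.PosDef.log_det_sub_log_det_eq_iff {R S : Matrix ι ι ℂ} (hR : R.PosDef)
    (hS : S.PosDef) :
    Real.log S.det.re - Real.log R.det.re = (R⁻¹ * S).trace.re - Fintype.card ι ↔ R = S := by
  obtain ⟨B, hB⟩ : ∃ B : Matrix ι ι ℂ, R⁻¹ = Bᴴ * B := by
    open scoped MatrixOrder in
    obtain ⟨B, hB⟩ := CStarAlgebra.nonneg_iff_eq_star_mul_self.mp hR.inv.posSemidef.nonneg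
    exact ⟨B, hB⟩
  have hRunit : IsUnit R.det := (isUnit_iff_isUnit_det R).1 hR.isUnit
  have hBunit : IsUnit B := by
    have h : IsUnit (Bᴴ * B).det := hB ▸ (isUnit_iff_isUnit_det _).1 hR.inv.isUnit
    rw [det_mul] at h
    exact (isUnit_iff_isUnit_det B).2 (isUnit_of_mul_isUnit_right h)
  have hA : (B * S * Bᴴ).PosDef := by
    simpa using hS.conjTranspose_mul_mul_same (B := Bᴴ)
      (mulVec_injective_of_isUnit (by simpa [star_eq_conjTranspose] using hBunit.star))
  have htrace : (B * S * Bᴴ).trace = (R⁻¹ * S).trace := by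
    rw [hB, trace_mul_cycle]
  have hdet : R.det * (B * S * Bᴴ).det = S.det := by
    have h : R.det * (Bᴴ * B).det = 1 := by
      rw [← hB, ← det_mul, mul_nonsing_inv R hRunit, det_one]
    rw [det_mul] at h
    rw [det_mul, det_mul]
    linear_combination S.det * h
  have hRpos := Complex.pos_iff.1 hR.det_pos
  have hApos := Complex.pos_iff.1 hA.det_pos
  have hdetre : S.det.re = R.det.re * (B * S * Bᴴ).det.re := by
    rw [← hdet, Complex.mul_re, ← hRpos.2]
    simp
  have hiff : B * S * Bᴴ = 1 ↔ R = S := by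
    constructor
    · intro h
      have h1 : Bᴴ * (B * S) = 1 := mul_eq_one_comm.1 h
      rw [← Matrix.mul_assoc, ← hB] at h1
      rw [← mul_one R, ← h1, ← Matrix.mul_assoc, mul_nonsing_inv R hRunit, Matrix.one_mul]
    · rintro rfl
      rw [mul_eq_one_comm, ← Matrix.mul_assoc, ← hB, nonsing_inv_mul R hRunit]
  rw [← hiff, ← hA.log_det_eq_trace_sub_card_iff, htrace, hdetre,
    Real.log_mul hRpos.1.ne' hApos.1.ne', add_sub_cancel_left]

end LogDetTrace

/-- For integers `n, m ≥ 1` and Hermitian positive definite `S`, a Hermitian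
positive definite `R` attains the bound
`(det R)^{-m} · exp(−Re tr(R⁻¹ S)) = m^{mn} · e^{−mn} · (det S)^{-m}`
if and only if `R = (1/m) • S`; i.e. `R = S/m` is the unique maximizer. -/
theorem gaussian_profile_eq_iff (n m : ℕ) (hn : 1 ≤ n) (hm : 1 ≤ m)
    (S : Matrix (Fin n) (Fin n) ℂ) (hS : S.PosDef)
    (R : Matrix (Fin n) (Fin n) ℂ) (hR : R.PosDef) :
    (R.det.re)⁻¹ ^ m * Real.exp (-((R⁻¹ * S).trace.re)) =
      (m : ℝ) ^ (m * n) * Real.exp (-((m : ℝ) * n)) * (S.det.re)⁻¹ ^ m ↔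
    R = ((m : ℂ))⁻¹ • S := by
  have hm0 : (0 : ℝ) < m := by exact_mod_cast hm
  have hmC : (0 : ℂ) < m := by exact_mod_cast hm
  have hRpos : 0 < R.det.re := (Complex.pos_iff.1 hR.det_pos).1
  have hSpos : 0 < S.det.re := (Complex.pos_iff.1 hS.det_pos).1
  have hRunit : IsUnit R.det := (isUnit_iff_isUnit_det R).1 hR.isUnit
  have hdet : ((m : ℂ) • R).det.re = (m : ℝ) ^ n * R.det.re := by
    rw [det_smul, Fintype.card_fin, ← Complex.ofReal_natCast, ← Complex.ofReal_pow,
      Complex.re_ofReal_mul]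
  have htrace : (((m : ℂ) • R)⁻¹ * S).trace.re = (m : ℝ)⁻¹ * (R⁻¹ * S).trace.re := by
    have hinv : ((m : ℂ) • R)⁻¹ = (m : ℂ)⁻¹ • R⁻¹ :=
      inv_eq_left_inv (by simp [smul_smul, hmC.ne', nonsing_inv_mul R hRunit])
    rw [hinv, smul_mul, trace_smul, smul_eq_mul, ← Complex.ofReal_natCast,
      ← Complex.ofReal_inv, Complex.re_ofReal_mul]
  have hlog := (hR.smul hmC).log_det_sub_log_det_eq_iff hS
  rw [hdet, htrace, Real.log_mul (by positivity) hRpos.ne', Real.log_pow,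
    Fintype.card_fin] at hlog
  rw [eq_inv_smul_iff₀ hmC.ne', ← hlog,
    ← Real.log_injOn_pos.eq_iff (Set.mem_Ioi.2 (by positivity)) (Set.mem_Ioi.2 (by positivity)),
    Real.log_mul (by positivity) (by positivity), Real.log_mul (by positivity) (by positivity),
    Real.log_mul (by positivity) (by positivity)]
  simp only [Real.log_pow, Real.log_inv, Real.log_exp, Nat.cast_mul]
  field_simp
  constructor <;> intro h <;> linarith
end

section
/- Let N, K be integers with 1 ≤ N ≤ K, let z, v, z₁, …, z_K ∈ ℂᴺ, α̂ ∈ ℂ, let γ₁, …, γ_K be positive reals, and let g′₁, …, g′_{h−1}, g_h, …, g_K be positive reals for some h ∈ {1, …, K}. Set ζ_k = γ_k^{−1/2} z_k, and define B_h = (z − α̂v)(z − α̂v)† + Σ_{k<h} (1/(γ_k g′_k)) z_k z_k† + Σ_{k>h} (1/(γ_k g_k)) z_k z_k† and B̃_h = (z − α̂v)(z − α̂v)† + Σ_{k<h} (1/g′_k) ζ_k ζ_k† + Σ_{k>h} (1/g_k) ζ_k ζ_k†. Then B_h = B̃_h, and if this matrix is invertible, the updated scale estimate satisfies ((K+1−N)/N)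 · z_h† B_h⁻¹ z_h = γ_h · ((K+1−N)/N) · ζ_h† B̃_h⁻¹ ζ_h; i.e., the update γ̂_h⁺ = ((K+1−N)/N) z_h†B_h⁻¹z_h has the form γ_h times a function of (z, ζ₁, …, ζ_K, g′, g) only. -/
open Matrix

/-- The rank-one matrix `w w†`, with entries `w i * conj (w j)`. -/
def outer {N : ℕ} (w : Fin N → ℂ) : Matrix (Fin N) (Fin N) ℂ :=
  Matrix.vecMulVec w (star w)

/-- Real scaling of a vector scales its rank-one matrix by the square. -/
theorem outer_real_smul {N : ℕ} (c : ℝ) (w : Fin N → ℂ) :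
    outer (c • w) = ((c * c : ℝ) : ℂ) • outer w := by
  ext i j
  simp only [outer, vecMulVec_apply, Pi.smul_apply, Pi.star_apply, star_smul, star_trivial,
    Matrix.smul_apply, Complex.real_smul, smul_eq_mul, Complex.ofReal_mul]
  ring

/-- Real scaling of a vector scales a sesquilinear form by the square. -/
theorem star_dotProduct_mulVec_real_smul {N : ℕ} (c : ℝ) (M : Matrix (Fin N) (Fin N) ℂ)
    (w : Fin N → ℂ) :
    star (c • w) ⬝ᵥ M *ᵥ (c • w) = ((c * c : ℝ) : ℂ) * (star w ⬝ᵥ M *ᵥ w) := by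
  simp only [star_smul, star_trivial, mulVec_smul, smul_dotProduct, dotProduct_smul,
    Complex.real_smul, Complex.ofReal_mul]
  ring

theorem inv_sqrt_mul_inv_sqrt {x : ℝ} (hx : 0 ≤ x) : (√x)⁻¹ * (√x)⁻¹ = x⁻¹ := by
  rw [← mul_inv, Real.mul_self_sqrt hx]

/-- With `ζ_k = γ_k^{−1/2} z_k`,
`B_h = (z − α̂v)(z − α̂v)† + Σ_{k<h} (1/(γ_k g′_k)) z_k z_k† + Σ_{k>h} (1/(γ_k g_k)) z_k z_k†`
and `B̃_h` built from the `ζ_k` with factors `g′_k, g_k`, one has `B_h = B̃_h`, and if this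
matrix is invertible, `((K+1−N)/N)·z_h†B_h⁻¹z_h = γ_h · ((K+1−N)/N)·ζ_h†B̃_h⁻¹ζ_h`;
i.e. the scale update equals `γ_h` times a function of the normalized data only. -/
theorem gamma_update_scale_equivariance {N K : ℕ} (hN : 1 ≤ N) (hNK : N ≤ K)
    (z v : Fin N → ℂ) (αhat : ℂ) (zk : Fin K → (Fin N → ℂ))
    (γ g' g : Fin K → ℝ) (hγ : ∀ k, 0 < γ k) (hg' : ∀ k, 0 < g' k) (hg : ∀ k, 0 < g k)
    (h : Fin K)
    (ζ : Fin K → (Fin N → ℂ)) (hζ : ∀ k, ζ k = ((Real.sqrt (γ k))⁻¹ : ℝ) • zk k)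
    (B Btil : Matrix (Fin N) (Fin N) ℂ)
    (hB : B = outer (z - αhat • v) +
        ∑ k ∈ Finset.univ.filter (fun k => k < h), ((γ k * g' k : ℝ) : ℂ)⁻¹ • outer (zk k) +
        ∑ k ∈ Finset.univ.filter (fun k => h < k), ((γ k * g k : ℝ) : ℂ)⁻¹ • outer (zk k))
    (hBtil : Btil = outer (z - αhat • v) +
        ∑ k ∈ Finset.univ.filter (fun k => k < h), ((g' k : ℝ) : ℂ)⁻¹ • outer (ζ k) +
        ∑ k ∈ Finset.univ.filter (fun k => h < k), ((g k : ℝ) : ℂ)⁻¹ • outer (ζ k)) :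
    B = Btil ∧
    (IsUnit B.det →
      ((((K : ℂ) + 1 - (N : ℂ)) / (N : ℂ)) * (star (zk h) ⬝ᵥ B⁻¹ *ᵥ zk h)) =
        (γ h : ℂ) * ((((K : ℂ) + 1 - (N : ℂ)) / (N : ℂ)) *
          (star (ζ h) ⬝ᵥ Btil⁻¹ *ᵥ ζ h))) := by
  have hscale : ∀ (k : Fin K) (a : ℝ),
      ((γ k * a : ℝ) : ℂ)⁻¹ • outer (zk k) = (a : ℂ)⁻¹ • outer (ζ k) := by
    intro k a
    rw [hζ k, outer_real_smul, inv_sqrt_mul_inv_sqrt (hγ k).le, smul_smul,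
      Complex.ofReal_mul, Complex.ofReal_inv, _root_.mul_inv_rev]
  have hBB : B = Btil := by
    simp only [hB, hBtil, hscale]
  refine ⟨hBB, fun _ => ?_⟩
  have hγh : (γ h : ℂ) ≠ 0 := Complex.ofReal_ne_zero.mpr (hγ h).ne'
  rw [← hBB, hζ h, star_dotProduct_mulVec_real_smul, inv_sqrt_mul_inv_sqrt (hγ h).le,
    Complex.ofReal_inv, mul_left_comm, mul_inv_cancel_left₀ hγh]
end
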